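/- arXiv:2106.15780 — 10 statements merged into one kernel-verified Lean document; each statement's English description precedes it below -/
import Mathlib

section
/- Let ≺ be a transitive relation on ℕ. Then the relation ≺_V on B (defined via ≺) is transitive. -/
open TopologicalSpace
open scoped Classical NNRat NNReal ENNReal

/-- An ideal with respect to a (transitive) relation: a nonempty, lower, directed subset. -/
def IsIdeal {α : Type*} (prec : α → α → Prop) (I : Set α) : Prop :=
  I.Nonempty ∧ (∀ a ∈ I, ∀ b, prec b a → b ∈ I) ∧
    ∀ a ∈ I, ∀ b ∈ I, ∃ c ∈ I, prec a c ∧ prec b c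

/-- The space of ideals of a relation. -/
def IdealSpace {α : Type*} (prec : α → α → Prop) : Type _ := {I : Set α // IsIdeal prec I}

/-- The basic open set `[n]_≺ = {I ∈ I(≺) : n ∈ I}`. -/
def basicOpen {α : Type*} (prec : α → α → Prop) (n : α) : Set (IdealSpace prec) :=
  {I | n ∈ I.1}

/-- The topology on the space of ideals, generated by the basic open sets. -/
instance {α : Type*} (prec : α → α → Prop) : TopologicalSpace (IdealSpace prec) :=
  TopologicalSpace.generateFrom {U | ∃ n, U = basicOpen prec n}

theorem isOpen_basicOpen {α : Type*} (prec : α → α → Prop) (n : α) :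
    IsOpen (basicOpen prec n) :=
  TopologicalSpace.isOpen_generateFrom_of_mem ⟨n, rfl⟩

/-- `[n]_≺` as an element of the open-set lattice. -/
def basicOpens {α : Type*} (prec : α → α → Prop) (n : α) : Opens (IdealSpace prec) :=
  ⟨basicOpen prec n, isOpen_basicOpen prec n⟩

/-- The relation `≺_V` on the set `B` of partial functions from `ℕ` to the positive
rationals with finite domain (modelled as finitely supported functions `ℕ →₀ ℚ≥0`,
with domain the support):  `r ≺_V s` iff for every nonempty `F ⊆ dom r`,
`∑_{b ∈ F} r b < ∑_{c ∈ ↑F ∩ dom s} s c`, where `↑F = {c | ∃ b ∈ F, b ≺ c}`. -/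
def precV (prec : ℕ → ℕ → Prop) (r s : ℕ →₀ ℚ≥0) : Prop :=
  ∀ F : Finset ℕ, F.Nonempty → F ⊆ r.support →
    ∑ b ∈ F, r b < ∑ c ∈ s.support.filter (fun c => ∃ b ∈ F, prec b c), s c

/-- The relation `≺_U` on finite subsets of `ℕ`. -/
def precU (prec : ℕ → ℕ → Prop) (F G : Finset ℕ) : Prop :=
  ∀ n ∈ G, ∃ m ∈ F, prec m n

/-- A (Scott-continuous) valuation on a topological space: a Scott-continuous, strict,
modular function from the open-set lattice to `[0,∞]`. -/
structure Valuation' (X : Type*) [TopologicalSpace X] where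
  toFun : Opens X → ℝ≥0∞
  scott' : ScottContinuous toFun
  strict' : toFun ⊥ = 0
  modular' : ∀ U V : Opens X, toFun U + toFun V = toFun (U ⊔ V) + toFun (U ⊓ V)

/-- The weak topology on the space of valuations, generated by the subbasic opens
`⟨U, q⟩ = {ν | ν U > q}` for `U` open and `q < ∞`. -/
instance {X : Type*} [TopologicalSpace X] : TopologicalSpace (Valuation' X) :=
  TopologicalSpace.generateFrom
    {S | ∃ (U : Opens X) (q : ℝ≥0∞), q ≠ ⊤ ∧ S = {ν : Valuation' X | q < ν.toFun U}}

/-- The union `⋃_{b ∈ F} [b]_≺` as an open set. -/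
def unionOpens (prec : ℕ → ℕ → Prop) (F : Finset ℕ) : Opens (IdealSpace prec) :=
  ⟨⋃ b ∈ F, basicOpen prec b, isOpen_biUnion fun b _ => isOpen_basicOpen prec b⟩

/-- The set `f_V(ν) = {r ∈ B | ∑_{b∈F} r b < ν (⋃_{b∈F} [b]_≺) for every nonempty F ⊆ dom r}`. -/
def fVset (prec : ℕ → ℕ → Prop) (ν : Valuation' (IdealSpace prec)) : Set (ℕ →₀ ℚ≥0) :=
  {r | ∀ F : Finset ℕ, F.Nonempty → F ⊆ r.support →
    (∑ b ∈ F, ((r b : ℝ≥0) : ℝ≥0∞)) < ν.toFun (unionOpens prec F)}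

/-- The function `g_V(I) = λ U. ⨆ {∑_{b ∈ dom r} r b | r ∈ I and ⋃_{b ∈ dom r} [b]_≺ ⊆ U}`. -/
noncomputable def gVfun (prec : ℕ → ℕ → Prop) (I : Set (ℕ →₀ ℚ≥0))
    (U : Opens (IdealSpace prec)) : ℝ≥0∞ :=
  ⨆ r ∈ {r : ℕ →₀ ℚ≥0 | r ∈ I ∧ unionOpens prec r.support ≤ U},
    ∑ b ∈ r.support, ((r b : ℝ≥0) : ℝ≥0∞)

/-- The set `g_U(J) = {I ∈ I(≺) | ∀ F ∈ J, ∃ m ∈ I, m ∈ F}`. -/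
def gUset (prec : ℕ → ℕ → Prop) (J : Set (Finset ℕ)) : Set (IdealSpace prec) :=
  {I | ∀ F ∈ J, ∃ m ∈ I.1, m ∈ F}

/-- If `≺` is a transitive relation on `ℕ`, then `≺_V` is transitive. -/
theorem precV_transitive (prec : ℕ → ℕ → Prop) (htrans : Transitive prec) :
    Transitive (precV prec) := by
  intro r s t hrs hst F hF hFr
  have h_lt := hrs F hF hFr
  refine (h_lt.trans (hst _ ?_ (Finset.filter_subset _ _))).trans_le ?_
  · exact Finset.nonempty_of_sum_ne_zero (ne_bot_of_gt h_lt)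
  · refine Finset.sum_le_sum_of_subset (Finset.monotone_filter_right _ fun c _ hc => ?_)
    obtain ⟨b, hb, hbc⟩ := hc
    obtain ⟨-, a, ha, hab⟩ := Finset.mem_filter.mp hb
    exact ⟨a, ha, htrans hab hbc⟩
end

section
/- Let ≺ be a transitive relation on ℕ. If I is an ideal with respect to ≺_V, r ∈ I, and A ⊆ dom(r), then the restriction r|_A of r to domain A is also in I. -/
open TopologicalSpace
open scoped Classical NNRat NNReal ENNReal

theorem precV_filter (prec : ℕ → ℕ → Prop) {r s : ℕ →₀ ℚ≥0} (h : precV prec r s)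
    (p : ℕ → Prop) [DecidablePred p] : precV prec (r.filter p) s := by
  intro F hF hFr
  rw [Finsupp.support_filter] at hFr
  rw [Finset.sum_congr rfl fun b hb =>
    Finsupp.filter_apply_pos p r (Finset.mem_filter.1 (hFr hb)).2]
  exact h F hF (hFr.trans (Finset.filter_subset _ _))

/-- If `I` is an ideal with respect to `≺_V`, `r ∈ I`, and `A ⊆ dom r`,
then the restriction of `r` to `A` is also in `I`. -/
theorem restriction_mem_ideal (prec : ℕ → ℕ → Prop) (htrans : Transitive prec)
    (I : Set (ℕ →₀ ℚ≥0)) (hI : IsIdeal (precV prec) I)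
    (r : ℕ →₀ ℚ≥0) (hr : r ∈ I) (A : Finset ℕ) (hA : A ⊆ r.support) :
    r.filter (· ∈ A) ∈ I := by
  obtain ⟨-, lower, directed⟩ := hI
  obtain ⟨c, hc, hrc, -⟩ := directed r hr r hr
  exact lower c hc _ (precV_filter prec hrc _)
end

section
/- Let ≺ be a transitive relation on ℕ and let J be an ideal with respect to ≺_U. Then the set g_U(J) = { I ∈ I(≺) : for every F ∈ J there exists m ∈ I with m ∈ F } is a compact saturated subset of the space of ideals I(≺) (saturated meaning g_U(J) equals the intersection of its open neighborhoods). -/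
open TopologicalSpace
open scoped Classical NNRat NNReal ENNReal

/-- An ideal with respect to a relation on a countable type contains a cofinal increasing
sequence. -/
theorem IsIdeal.exists_cofinal_seq {α : Type*} [Countable α] {prec : α → α → Prop} {I : Set α}
    (hI : IsIdeal prec I) :
    ∃ f : ℕ → α, (∀ n, f n ∈ I) ∧ (∀ n, prec (f n) (f (n + 1))) ∧
      ∀ a ∈ I, ∃ n, prec a (f n) := by
  obtain ⟨hne, -, hdir⟩ := hI
  have : Nonempty I := hne.to_subtype
  obtain ⟨e, he⟩ := exists_surjective_nat I
  have step (x y : I) : ∃ z : I, prec x z ∧ prec y z := by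
    obtain ⟨z, hz, h⟩ := hdir x x.2 y y.2
    exact ⟨⟨z, hz⟩, h⟩
  choose s hs using step
  let f : ℕ → I := fun n => Nat.rec (e 0) (fun k x => s x (e k)) n
  refine ⟨fun n => (f n).1, fun n => (f n).2, fun n => (hs (f n) (e n)).1, fun a ha => ?_⟩
  obtain ⟨n, hn⟩ := he ⟨a, ha⟩
  have h : prec (e n) (f (n + 1)) := (hs (f n) (e n)).2
  rw [hn] at h
  exact ⟨n + 1, h⟩

/-- Kőnig's lemma for a sequence of nonempty finite sets in which every element of a level is
related to some element of the previous level. -/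
theorem exists_seq_mem_of_finite_levels {α : Type*} {r : α → α → Prop} {S : ℕ → Set α}
    (hfin : ∀ n, (S n).Finite) (hne : ∀ n, (S n).Nonempty)
    (hpred : ∀ n, ∀ b ∈ S (n + 1), ∃ a ∈ S n, r a b) :
    ∃ m : ℕ → α, (∀ n, m n ∈ S n) ∧ ∀ n, r (m n) (m (n + 1)) := by
  have path (n : ℕ) : ∀ b ∈ S n, ∃ p : ℕ → α, p n = b ∧ (∀ j ≤ n, p j ∈ S j) ∧
      ∀ j < n, r (p j) (p (j + 1)) := by
    induction n with
    | zero =>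
      intro b hb
      refine ⟨fun _ => b, rfl, fun j hj => ?_, fun j hj => absurd hj (Nat.not_lt_zero j)⟩
      obtain rfl := Nat.le_zero.mp hj
      exact hb
    | succ n ih =>
      intro b hb
      obtain ⟨a, ha, hab⟩ := hpred n b hb
      obtain ⟨p, hpa, hpS, hpr⟩ := ih a ha
      refine ⟨fun j => if j ≤ n then p j else b, by simp, fun j hj => ?_, fun j hj => ?_⟩
      · by_cases h : j ≤ n
        · simpa [h] using hpS j h
        · obtain rfl : j = n + 1 := by omega
          simpa using hb
      · rcases Nat.lt_succ_iff_lt_or_eq.mp hj with h | rfl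
        · simpa [h.le, Nat.succ_le_of_lt h] using hpr j h
        · simpa [hpa] using hab
  choose b hb using hne
  choose p _ hpS hpr using fun n => path n (b n) (hb n)
  have key (j : ℕ) : ∃ a ∈ S j, ∀ᶠ n in (Filter.hyperfilter ℕ : Filter ℕ), p n j = a := by
    rw [← Ultrafilter.eventually_exists_mem_iff (hfin j)]
    have h : ∀ᶠ n in Filter.atTop, j ≤ n := Filter.eventually_ge_atTop j
    exact (h.filter_mono Nat.hyperfilter_le_atTop).mono fun n hn => ⟨_, hpS n j hn, rfl⟩
  choose m hmS hm using key
  refine ⟨m, hmS, fun j => ?_⟩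
  have h : ∀ᶠ n in (Filter.hyperfilter ℕ : Filter ℕ), j < n :=
    (Filter.eventually_gt_atTop j).filter_mono Nat.hyperfilter_le_atTop
  obtain ⟨n, hn, h1, h2⟩ := (h.and ((hm j).and (hm (j + 1)))).exists
  rw [← h1, ← h2]
  exact hpr n j hn

/-- The lower set generated by an increasing sequence is an ideal. -/
theorem isIdeal_setOf_exists_prec_seq {α : Type*} {prec : α → α → Prop} [IsTrans α prec]
    {m : ℕ → α} (hm : ∀ n, prec (m n) (m (n + 1))) : IsIdeal prec {a | ∃ n, prec a (m n)} := by
  have lift {a : α} {i j : ℕ} (hij : i ≤ j) (h : prec a (m i)) : prec a (m j) := by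
    induction j, hij using Nat.le_induction with
    | base => exact h
    | succ j _ ih => exact _root_.trans ih (hm j)
  refine ⟨⟨m 0, 1, hm 0⟩, fun a ⟨n, hn⟩ b hb => ⟨n, _root_.trans hb hn⟩, ?_⟩
  rintro a ⟨i, hi⟩ b ⟨j, hj⟩
  exact ⟨m (max i j), ⟨_, hm _⟩, lift (le_max_left i j) hi, lift (le_max_right i j) hj⟩

/-- If the basic open sets indexed by `A` cover `g_U(J)`, then some member of `J` consists of
elements above `A`. -/
theorem exists_mem_forall_of_gUset_subset {prec : ℕ → ℕ → Prop} [IsTrans ℕ prec]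
    {J : Set (Finset ℕ)} (hJ : IsIdeal (precU prec) J) {A : Set ℕ}
    (hA : gUset prec J ⊆ ⋃ a ∈ A, basicOpen prec a) :
    ∃ F ∈ J, ∀ n ∈ F, ∃ a ∈ A, a = n ∨ prec a n := by
  by_contra! hcon
  obtain ⟨f, hfJ, hf, hcof⟩ := hJ.exists_cofinal_seq
  obtain ⟨m, hmS, hm⟩ := exists_seq_mem_of_finite_levels (r := prec)
    (S := fun i => {n | n ∈ f i ∧ ∀ a ∈ A, a ≠ n ∧ ¬ prec a n})
    (fun i => (f i).finite_toSet.subset fun n hn => hn.1) (fun i => hcon (f i) (hfJ i))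
    (by
      rintro i b ⟨hb, hbA⟩
      obtain ⟨a, ha, hab⟩ := hf i b hb
      refine ⟨a, ⟨ha, fun c hc => ⟨?_, fun hca => (hbA c hc).2 (_root_.trans hca hab)⟩⟩, hab⟩
      rintro rfl
      exact (hbA c hc).2 hab)
  let I : IdealSpace prec := ⟨_, isIdeal_setOf_exists_prec_seq hm⟩
  have hI : I ∈ gUset prec J := by
    intro F hF
    obtain ⟨i, hi⟩ := hcof F hF
    obtain ⟨k, hk, hki⟩ := hi (m i) (hmS i).1
    exact ⟨k, ⟨i, hki⟩, hk⟩
  obtain ⟨a, ha, i, hi⟩ := Set.mem_iUnion₂.mp (hA hI)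
  exact ((hmS i).2 a ha).2 hi

theorem isCompact_gUset {prec : ℕ → ℕ → Prop} [IsTrans ℕ prec]
    {J : Set (Finset ℕ)} (hJ : IsIdeal (precU prec) J) : IsCompact (gUset prec J) := by
  refine isCompact_generateFrom rfl fun P hP hcov => ?_
  obtain ⟨F, hFJ, hF⟩ := exists_mem_forall_of_gUset_subset hJ
    (A := {n | basicOpen prec n ∈ P}) (by
      intro I hI
      obtain ⟨U, hU, hIU⟩ := hcov hI
      obtain ⟨n, rfl⟩ := hP hU
      exact Set.mem_iUnion₂.mpr ⟨n, hU, hIU⟩)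
  choose! a haP ha using hF
  refine ⟨(fun n => basicOpen prec (a n)) '' F, ?_, F.finite_toSet.image _, ?_⟩
  · rintro _ ⟨n, hn, rfl⟩
    exact haP n hn
  · intro I hI
    obtain ⟨n, hnI, hnF⟩ := hI F hFJ
    refine ⟨_, ⟨n, hnF, rfl⟩, ?_⟩
    rcases ha n hnF with h | h
    · exact Set.mem_of_eq_of_mem (s := I.1) h hnI
    · exact I.2.2.1 n hnI _ h

theorem gUset_eq_sInter_isOpen (prec : ℕ → ℕ → Prop) (J : Set (Finset ℕ)) :
    gUset prec J = ⋂₀ {U : Set (IdealSpace prec) | IsOpen U ∧ gUset prec J ⊆ U} := by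
  refine Set.Subset.antisymm (Set.subset_sInter fun U hU => hU.2) fun I hI F hF => ?_
  have h := hI (unionOpens prec F) ⟨(unionOpens prec F).isOpen, fun K hK => by
    obtain ⟨n, hnK, hnF⟩ := hK F hF
    exact Set.mem_iUnion₂.mpr ⟨n, hnF, hnK⟩⟩
  obtain ⟨n, hnF, hnI⟩ := Set.mem_iUnion₂.mp h
  exact ⟨n, hnI, hnF⟩

/-- For an ideal `J` with respect to `≺_U`, the set `g_U(J)` is a compact
saturated subset of the space of ideals `I(≺)`. -/
theorem gUset_isCompact_saturated (prec : ℕ → ℕ → Prop) (htrans : Transitive prec)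
    (J : Set (Finset ℕ)) (hJ : IsIdeal (precU prec) J) :
    IsCompact (gUset prec J) ∧
      gUset prec J = ⋂₀ {U : Set (IdealSpace prec) | IsOpen U ∧ gUset prec J ⊆ U} :=
  have : IsTrans ℕ prec := ⟨fun _ _ _ hab hbc => htrans hab hbc⟩
  ⟨isCompact_gUset hJ, gUset_eq_sInter_isOpen prec J⟩
end

section
/- Let ≺ be a transitive relation on ℕ, let J be an ideal with respect to ≺_U, and let g_U(J) = { I ∈ I(≺) : for every F ∈ J there exists m ∈ I with m ∈ F }. Then for any S ⊆ ℕ, g_U(J) ⊆ ⋃_{b∈S} [b]_≺ if and only if there is a finite F ⊆ S with F ∈ J. -/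
open TopologicalSpace
open scoped Classical NNRat NNReal ENNReal

open CategoryTheory in
/-- Finite nonempty types linked by maps `X (n + 1) → X n` admit a compatible sequence. -/
theorem exists_compatible_seq {X : ℕ → Type} [∀ n, Finite (X n)] [∀ n, Nonempty (X n)]
    (f : ∀ n, X (n + 1) → X n) : ∃ a : ∀ n, X n, ∀ n, f n (a (n + 1)) = a n := by
  let D : ℕᵒᵖ ⥤ Type :=
    Functor.ofOpSequence (X := X) fun n => ↾(f n)
  have hfin : ∀ j, Finite (D.obj j) := fun j => inferInstanceAs (Finite (X j.unop))
  have hne : ∀ j, Nonempty (D.obj j) := fun j => inferInstanceAs (Nonempty (X j.unop))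
  obtain ⟨u, hu⟩ := nonempty_sections_of_finite_inverse_system D
  refine ⟨fun n => u (Opposite.op n), fun n => ?_⟩
  have h := hu (homOfLE (Nat.le_add_right n 1)).op
  rwa [Functor.ofOpSequence_map_homOfLE_succ] at h

/-- The elements lying below some term of an increasing sequence form an ideal. -/
theorem isIdeal_setOf_exists_prec {α : Type*} {prec : α → α → Prop} [IsTrans α prec]
    {a : ℕ → α} (ha : ∀ n, prec (a n) (a (n + 1))) : IsIdeal prec {x | ∃ n, prec x (a n)} := by
  have mono : ∀ {x n m}, n ≤ m → prec x (a n) → prec x (a m) := by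
    intro x n m hnm hx
    induction hnm with
    | refl => exact hx
    | step _ ih => exact _root_.trans ih (ha _)
  refine ⟨⟨a 0, 1, ha 0⟩, fun x ⟨n, hn⟩ y hy => ⟨n, _root_.trans hy hn⟩, ?_⟩
  rintro x ⟨n, hn⟩ y ⟨m, hm⟩
  exact ⟨a (max n m), ⟨_, ha _⟩, mono (le_max_left n m) hn, mono (le_max_right n m) hm⟩

/-- An ideal for `≺_U` contains a `≺_U`-increasing cofinal sequence. -/
theorem exists_cofinal_seq {prec : ℕ → ℕ → Prop} {J : Set (Finset ℕ)}
    (hJ : IsIdeal (precU prec) J) :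
    ∃ F : ℕ → Finset ℕ, (∀ n, F n ∈ J) ∧ (∀ n, precU prec (F n) (F (n + 1))) ∧
      ∀ G ∈ J, ∃ n, precU prec G (F n) := by
  obtain ⟨⟨F₀, hF₀⟩, -, hdir⟩ := hJ
  have : Inhabited J := ⟨⟨F₀, hF₀⟩⟩
  have : Encodable J := Encodable.ofCountable J
  have hd : Directed (precU prec) ((↑) : J → Finset ℕ) := fun A B =>
    let ⟨C, hC, h⟩ := hdir A A.2 B B.2
    ⟨⟨C, hC⟩, h⟩
  exact ⟨fun n => hd.sequence _ n, fun n => (hd.sequence _ n).2, hd.sequence_mono_nat,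
    fun G hG => ⟨_, hd.rel_sequence ⟨G, hG⟩⟩⟩

/-- If no finite subset of `S` lies in the `≺_U`-ideal `J`, every member of `J` has an element
with no predecessor in `S`. -/
theorem exists_mem_forall_not_prec {prec : ℕ → ℕ → Prop} {J : Set (Finset ℕ)}
    (hJ : IsIdeal (precU prec) J) {S : Set ℕ} (hS : ∀ F : Finset ℕ, ↑F ⊆ S → F ∉ J)
    {F : Finset ℕ} (hF : F ∈ J) : ∃ x ∈ F, ∀ s ∈ S, ¬ prec s x := by
  by_contra! h
  choose! g hgS hg using h
  refine hS (F.image g) ?_ (hJ.2.1 F hF _ fun n hn => ⟨g n, Finset.mem_image_of_mem g hn, hg n hn⟩)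
  rw [Finset.coe_image]
  exact Set.image_subset_iff.2 hgS

/-- For an ideal `J` with respect to `≺_U` and any `S ⊆ ℕ`,
`g_U(J) ⊆ ⋃_{b ∈ S} [b]_≺` iff there is a finite `F ⊆ S` with `F ∈ J`. -/
theorem gUset_subset_iUnion_iff (prec : ℕ → ℕ → Prop) (htrans : Transitive prec)
    (J : Set (Finset ℕ)) (hJ : IsIdeal (precU prec) J) (S : Set ℕ) :
    gUset prec J ⊆ ⋃ b ∈ S, basicOpen prec b ↔ ∃ F : Finset ℕ, ↑F ⊆ S ∧ F ∈ J := by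
  constructor
  · intro hsub
    by_contra! hS
    have : IsTrans ℕ prec := ⟨fun _ _ _ => @htrans _ _ _⟩
    obtain ⟨F, hFJ, hF, hcof⟩ := exists_cofinal_seq hJ
    let X : ℕ → Type := fun n => {x : ℕ // x ∈ F n ∧ ∀ s ∈ S, ¬ prec s x}
    have hfin (n : ℕ) : Finite (X n) :=
      ((F n).finite_toSet.subset fun _ hx => hx.1 : {x | x ∈ F n ∧ ∀ s ∈ S, ¬ prec s x}.Finite)
    have hne (n : ℕ) : Nonempty (X n) :=
      let ⟨x, hx⟩ := exists_mem_forall_not_prec hJ hS (hFJ n)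
      ⟨⟨x, hx⟩⟩
    have hpred (n : ℕ) (x : X (n + 1)) : ∃ y : X n, prec y.1 x.1 := by
      obtain ⟨y, hy, hyx⟩ := hF n x.1 x.2.1
      exact ⟨⟨y, hy, fun s hs hsy => x.2.2 s hs (htrans hsy hyx)⟩, hyx⟩
    choose f hf using hpred
    obtain ⟨a, ha⟩ := exists_compatible_seq f
    have hideal := isIdeal_setOf_exists_prec (a := fun n => (a n).1) fun n => by
      simpa only [ha] using hf n (a (n + 1))
    have hmem : (⟨_, hideal⟩ : IdealSpace prec) ∈ gUset prec J := by
      intro G hG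
      obtain ⟨n, hn⟩ := hcof G hG
      obtain ⟨m, hm, hmn⟩ := hn _ (a n).2.1
      exact ⟨m, ⟨n, hmn⟩, hm⟩
    obtain ⟨b, hb, n, hbn⟩ := Set.mem_iUnion₂.1 (hsub hmem)
    exact (a n).2.2 b hb hbn
  · rintro ⟨F, hFS, hFJ⟩ I hI
    obtain ⟨m, hmI, hmF⟩ := hI F hFJ
    exact Set.mem_iUnion₂.2 ⟨m, hFS hmF, hmI⟩
end

section
/- Let ≺ be a transitive relation on ℕ. If I is an ideal with respect to ≺_V and r ∈ I, then there exists s ∈ I with r ≺_V s and dom(r) ≺_U dom(s). -/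
open TopologicalSpace
open scoped Classical NNRat NNReal ENNReal

/-- Restricting the left-hand side of `≺_V` to a smaller domain preserves the relation. -/
theorem precV.filter_left {prec : ℕ → ℕ → Prop} {s t : ℕ →₀ ℚ≥0} (h : precV prec s t)
    (p : ℕ → Prop) [DecidablePred p] : precV prec (s.filter p) t := by
  intro F hF hFs
  rw [Finsupp.support_filter] at hFs
  have hsum : ∑ b ∈ F, s.filter p b = ∑ b ∈ F, s b :=
    Finset.sum_congr rfl fun b hb =>
      Finsupp.filter_apply_pos p s (Finset.mem_filter.1 (hFs hb)).2
  rw [hsum]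
  exact h F hF (hFs.trans (Finset.filter_subset _ _))

/-- Restricting the right-hand side of `r ≺_V s` to the upper set of `dom r` preserves the
relation. -/
theorem precV.filter_right {prec : ℕ → ℕ → Prop} {r s : ℕ →₀ ℚ≥0} (h : precV prec r s) :
    precV prec r (s.filter fun c => ∃ b ∈ r.support, prec b c) := by
  intro F hF hFr
  refine (h F hF hFr).trans_eq (Finset.sum_congr ?_ ?_)
  · ext c
    simp only [Finset.mem_filter, Finsupp.support_filter]
    exact ⟨fun ⟨hc, b, hb, hbc⟩ => ⟨⟨hc, b, hFr hb, hbc⟩, b, hb, hbc⟩,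
      fun ⟨⟨hc, _⟩, hF⟩ => ⟨hc, hF⟩⟩
  · intro c hc
    rw [Finset.mem_filter, Finsupp.support_filter, Finset.mem_filter] at hc
    exact (Finsupp.filter_apply_pos _ s hc.1.2).symm

/-- If `I` is an ideal with respect to `≺_V` and `r ∈ I`, then there exists
`s ∈ I` with `r ≺_V s` and `dom r ≺_U dom s`. -/
theorem exists_precV_precU (prec : ℕ → ℕ → Prop) (htrans : Transitive prec)
    (I : Set (ℕ →₀ ℚ≥0)) (hI : IsIdeal (precV prec) I) (r : ℕ →₀ ℚ≥0) (hr : r ∈ I) :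
    ∃ s ∈ I, precV prec r s ∧ precU prec r.support s.support := by
  obtain ⟨-, hlower, hdir⟩ := hI
  obtain ⟨s, hs, hrs, -⟩ := hdir r hr r hr
  obtain ⟨t, ht, hst, -⟩ := hdir s hs s hs
  refine ⟨s.filter fun c => ∃ b ∈ r.support, prec b c,
    hlower t ht _ (hst.filter_left _), hrs.filter_right, fun n hn => ?_⟩
  rw [Finsupp.support_filter, Finset.mem_filter] at hn
  exact hn.2
end

section
/- Let ≺ be a transitive relation on ℕ and let (r_i)_{i∈ℕ} be a sequence in B with r_i ≺_V r_{i+1} and dom(r_i) ≺_U dom(r_{i+1}) for all i. Then J = { F a finite subset of ℕ : ∃i, F ≺_U dom(r_i) } is an ideal with respect to ≺_U. -/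
open TopologicalSpace
open scoped Classical NNRat NNReal ENNReal

theorem precU.trans {prec : ℕ → ℕ → Prop} (htrans : Transitive prec) {F G H : Finset ℕ}
    (hFG : precU prec F G) (hGH : precU prec G H) : precU prec F H := by
  intro n hn
  obtain ⟨m, hm, hmn⟩ := hGH n hn
  obtain ⟨l, hl, hlm⟩ := hFG m hm
  exact ⟨l, hl, htrans hlm hmn⟩

/-- Along a `≺_U`-increasing sequence, being `≺_U`-below a term passes to later terms. -/
theorem precU.mono_right {prec : ℕ → ℕ → Prop} (htrans : Transitive prec) {G : ℕ → Finset ℕ}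
    (hG : ∀ i, precU prec (G i) (G (i + 1))) {F : Finset ℕ} {i j : ℕ} (hij : i ≤ j)
    (hF : precU prec F (G i)) : precU prec F (G j) := by
  induction j, hij using Nat.le_induction with
  | base => exact hF
  | succ k _ ih => exact ih.trans htrans (hG k)

/-- If `(r i)` is a sequence in `B` with `r i ≺_V r (i+1)` and
`dom (r i) ≺_U dom (r (i+1))` for all `i`, then `J = {F | ∃ i, F ≺_U dom (r i)}` is
an ideal with respect to `≺_U`. -/
theorem seq_gives_precU_ideal (prec : ℕ → ℕ → Prop) (htrans : Transitive prec)
    (r : ℕ → ℕ →₀ ℚ≥0) (h1 : ∀ i, precV prec (r i) (r (i + 1)))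
    (h2 : ∀ i, precU prec (r i).support (r (i + 1)).support) :
    IsIdeal (precU prec) {F : Finset ℕ | ∃ i, precU prec F (r i).support} := by
  refine ⟨⟨_, 0 + 1, h2 0⟩, ?_, ?_⟩
  · rintro F ⟨i, hF⟩ G hGF
    exact ⟨i, hGF.trans htrans hF⟩
  · rintro F ⟨i, hF⟩ G ⟨j, hG⟩
    exact ⟨(r (max i j)).support, ⟨max i j + 1, h2 _⟩,
      hF.mono_right htrans (G := fun k => (r k).support) h2 (le_max_left i j),
      hG.mono_right htrans (G := fun k => (r k).support) h2 (le_max_right i j)⟩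
end

section
/- Let ≺ be a transitive relation on ℕ, let D ⊆ ℕ be finite, and for each nonempty G ⊆ D set U_G = ⋂_{b∈G} [b]_≺ and V_G = U_G ∩ ⋃_{b∈D∖G} [b]_≺ (open subsets of the space of ideals I(≺)). Let P be an upper set of nonempty subsets of D (F ∈ P and F ⊆ G ⊆ D imply G ∈ P). If ν is a valuation on I(≺) with ν(U_G) < ∞ for each G ∈ P, then ∑_{G∈P} (ν(U_G) − ν(V_G)) = ν(⋃_{G∈P} U_G). -/
open TopologicalSpace
open scoped Classical NNRat NNReal ENNReal

/-- The meet of a minimal `G` with the join of the other members of an upper set of subsets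
of `D` is the meet of `G` with the join of the generators in `D \ G`. -/
theorem inf_inf_sup_erase_eq {ι L : Type*} [DecidableEq ι] [DistribLattice L] [BoundedOrder L]
    (u : ι → L) (D : Finset ι) (P : Finset (Finset ι))
    (hsub : ∀ G ∈ P, G ⊆ D)
    (hup : ∀ F ∈ P, ∀ G : Finset ι, F ⊆ G → G ⊆ D → G ∈ P)
    {G : Finset ι} (hG : G ∈ P) (hmin : ∀ F ∈ P, F ⊆ G → F = G) :
    G.inf u ⊓ ((P.erase G).sup fun F => F.inf u) = G.inf u ⊓ (D \ G).sup u := by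
  apply le_antisymm
  · rw [Finset.sup_inf_distrib_left]
    refine Finset.sup_le fun F hF => ?_
    obtain ⟨hne, hFP⟩ := Finset.mem_erase.1 hF
    obtain ⟨b, hbF, hbG⟩ := Finset.not_subset.1 fun h => hne (hmin F hFP h)
    exact inf_le_inf_left _ ((Finset.inf_le hbF).trans
      (Finset.le_sup (Finset.mem_sdiff.2 ⟨hsub F hFP hbF, hbG⟩)))
  · refine le_inf inf_le_left ?_
    rw [Finset.sup_inf_distrib_left]
    refine Finset.sup_le fun b hb => ?_
    obtain ⟨hbD, hbG⟩ := Finset.mem_sdiff.1 hb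
    have hmem : insert b G ∈ P.erase G :=
      Finset.mem_erase.2 ⟨Finset.insert_ne_self.2 hbG,
        hup G hG _ (Finset.subset_insert b G) (Finset.insert_subset hbD (hsub G hG))⟩
    calc G.inf u ⊓ u b = (insert b G).inf u := by rw [Finset.inf_insert, inf_comm]
      _ ≤ _ := Finset.le_sup (f := fun F : Finset ι => F.inf u) hmem

/-- For a monotone, strict, modular function on a bounded distributive lattice, the join of the
meets indexed by an upper set of subsets of `D` has as value a sum of differences. -/
theorem sum_tsub_eq_apply_sup {ι L : Type*} [DecidableEq ι] [DistribLattice L] [BoundedOrder L]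
    (u : ι → L) (f : L → ℝ≥0∞) (hmono : Monotone f) (hbot : f ⊥ = 0)
    (hmod : ∀ a b, f a + f b = f (a ⊔ b) + f (a ⊓ b))
    (D : Finset ι) (P : Finset (Finset ι))
    (hsub : ∀ G ∈ P, G ⊆ D)
    (hup : ∀ F ∈ P, ∀ G : Finset ι, F ⊆ G → G ⊆ D → G ∈ P)
    (hfin : ∀ G ∈ P, f (G.inf u) ≠ ⊤) :
    ∑ G ∈ P, (f (G.inf u) - f (G.inf u ⊓ (D \ G).sup u)) = f (P.sup fun G => G.inf u) := by
  induction P using Finset.strongInduction with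
  | H P ih =>
    obtain rfl | hne := P.eq_empty_or_nonempty
    · simp [hbot]
    obtain ⟨G, hG⟩ := P.exists_minimal hne
    have hGP := hG.prop
    have hmin : ∀ F ∈ P, F ⊆ G → F = G := fun F hF hFG => hG.eq_of_le hF hFG
    have ih' := ih (P.erase G) (Finset.erase_ssubset hGP)
      (fun F hF => hsub F (Finset.mem_of_mem_erase hF))
      (fun F hF H hFH hHD => by
        obtain ⟨hFne, hFP⟩ := Finset.mem_erase.1 hF
        refine Finset.mem_erase.2 ⟨?_, hup F hFP H hFH hHD⟩
        rintro rfl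
        exact hFne (hmin F hFP hFH))
      (fun F hF => hfin F (Finset.mem_of_mem_erase hF))
    have hle : f (G.inf u ⊓ (D \ G).sup u) ≤ f (G.inf u) := hmono inf_le_left
    have hVfin := ne_top_of_le_ne_top (hfin G hGP) hle
    have hsup : (P.sup fun F => F.inf u) = G.inf u ⊔ (P.erase G).sup fun F => F.inf u := by
      rw [← Finset.sup_insert (f := fun F : Finset ι => F.inf u), Finset.insert_erase hGP]
    have hmodG := hmod (G.inf u) ((P.erase G).sup fun F => F.inf u)
    rw [inf_inf_sup_erase_eq u D P hsub hup hGP hmin] at hmodG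
    rw [← Finset.add_sum_erase _ _ hGP, ih', hsup]
    refine (ENNReal.add_left_inj hVfin).1 ?_
    rw [← hmodG, add_right_comm, tsub_add_cancel_of_le hle]

/-- For a finite `D ⊆ ℕ`, an upper set `P` of nonempty subsets of `D`, and
a valuation `ν` on `I(≺)` with `ν (U_G) < ∞` for each `G ∈ P`, where
`U_G = ⋂_{b ∈ G} [b]_≺` and `V_G = U_G ∩ ⋃_{b ∈ D \ G} [b]_≺`, we have
`∑_{G ∈ P} (ν (U_G) - ν (V_G)) = ν (⋃_{G ∈ P} U_G)`. -/
theorem sum_of_differences (prec : ℕ → ℕ → Prop) (htrans : Transitive prec)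
    (D : Finset ℕ) (P : Finset (Finset ℕ))
    (hP1 : ∀ G ∈ P, G.Nonempty ∧ G ⊆ D)
    (hP2 : ∀ F ∈ P, ∀ G : Finset ℕ, F ⊆ G → G ⊆ D → G ∈ P)
    (ν : Valuation' (IdealSpace prec))
    (hfin : ∀ G ∈ P, ν.toFun (G.inf (basicOpens prec)) ≠ ⊤) :
    ∑ G ∈ P, (ν.toFun (G.inf (basicOpens prec)) -
        ν.toFun (G.inf (basicOpens prec) ⊓ (D \ G).sup (basicOpens prec)))
      = ν.toFun (P.sup fun G => G.inf (basicOpens prec)) := by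
  exact sum_tsub_eq_apply_sup (basicOpens prec) ν.toFun ν.scott'.monotone ν.strict' ν.modular' D P
    (fun G hG => (hP1 G hG).2) hP2 hfin
end

section
/- Let ≺ be a transitive relation on ℕ. The map f_V : V(I(≺)) → I(≺_V), f_V(ν) = { r ∈ B : ∑_{b∈F} r(b) < ν(⋃_{b∈F} [b]_≺) for every nonempty F ⊆ dom(r) }, is continuous from the space of valuations on I(≺) with the weak topology to the space of ideals I(≺_V). -/
open TopologicalSpace
open scoped Classical NNRat NNReal ENNReal

theorem isOpen_setOf_lt_valuation {X : Type*} [TopologicalSpace X] (U : Opens X) {q : ℝ≥0∞}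
    (hq : q ≠ ⊤) : IsOpen {ν : Valuation' X | q < ν.toFun U} :=
  isOpen_generateFrom_of_mem ⟨U, q, hq, rfl⟩

/-- Only finitely many `F ⊆ dom r` have to be tested, so membership of a fixed `r` in `fVset` is
an open condition on the valuation. -/
theorem isOpen_setOf_mem_fVset (prec : ℕ → ℕ → Prop) (r : ℕ →₀ ℚ≥0) :
    IsOpen {ν | r ∈ fVset prec ν} := by
  have h : {ν | r ∈ fVset prec ν} = ⋂ F ∈ r.support.powerset.filter Finset.Nonempty,
      {ν | (∑ b ∈ F, ((r b : ℝ≥0) : ℝ≥0∞)) < ν.toFun (unionOpens prec F)} := by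
    ext ν
    simp only [fVset, Set.mem_ofPred_eq, Set.mem_iInter, Finset.mem_filter, Finset.mem_powerset]
    exact ⟨fun hr F hF => hr F hF.2 hF.1, fun hr F hne hF => hr F ⟨hF, hne⟩⟩
  rw [h]
  exact isOpen_biInter_finset fun F _ => isOpen_setOf_lt_valuation _
    (ENNReal.sum_ne_top.2 fun _ _ => ENNReal.coe_ne_top)

/-- The map `f_V : V(I(≺)) → I(≺_V)` is continuous from the space of
valuations with the weak topology to the space of ideals of `≺_V`. -/
theorem fV_continuous (prec : ℕ → ℕ → Prop) (htrans : Transitive prec)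
    (fV : Valuation' (IdealSpace prec) → IdealSpace (precV prec))
    (hfV : ∀ ν, (fV ν).1 = fVset prec ν) :
    Continuous fV := by
  refine continuous_generateFrom_iff.2 ?_
  rintro _ ⟨r, rfl⟩
  have h : fV ⁻¹' basicOpen (precV prec) r = {ν | r ∈ fVset prec ν} :=
    Set.ext fun ν => by simp only [basicOpen, Set.mem_preimage, Set.mem_ofPred_eq, hfV]
  rw [h]
  exact isOpen_setOf_mem_fVset prec r
end

section
/- Let ≺ be a transitive relation on ℕ and let I be an ideal with respect to ≺_V. Define g_V(I)(U) = sup { ∑_{b∈dom(r)} r(b) : r ∈ I and ⋃_{b∈dom(r)} [b]_≺ ⊆ U } for U open in I(≺). Then g_V(I) is modular: g_V(I)(U) + g_V(I)(V) = g_V(I)(U∪V) + g_V(I)(U∩V) for all open U, V ⊆ I(≺). -/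
open TopologicalSpace
open scoped Classical NNRat NNReal ENNReal

section Mass

variable {prec : ℕ → ℕ → Prop}

/-- The total mass that `r` gives to the elements of its support satisfying `P`. -/
noncomputable def massOn (r : ℕ →₀ ℚ≥0) (P : ℕ → Prop) : ℚ≥0 :=
  ∑ b ∈ r.support with P b, r b

theorem massOn_mono (r : ℕ →₀ ℚ≥0) {P Q : ℕ → Prop} (h : ∀ b, P b → Q b) :
    massOn r P ≤ massOn r Q :=
  Finset.sum_le_sum_of_subset (Finset.monotone_filter_right _ fun b _ => h b)

theorem massOn_add_massOn (r : ℕ →₀ ℚ≥0) (P Q : ℕ → Prop) :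
    massOn r P + massOn r Q = massOn r (fun b => P b ∨ Q b) + massOn r (fun b => P b ∧ Q b) := by
  simp only [massOn, Finset.filter_or, Finset.filter_and]
  exact Finset.sum_union_inter.symm

theorem precV.sum_le {r s : ℕ →₀ ℚ≥0} (h : precV prec r s) {S : Finset ℕ} (hS : S ⊆ r.support) :
    ∑ b ∈ S, r b ≤ massOn s (fun c => ∃ b ∈ S, prec b c) := by
  rcases S.eq_empty_or_nonempty with rfl | hne
  · simp
  · convert (h S hne hS).le
    rw [massOn]
    congr!

theorem precV.massOn_le {r s : ℕ →₀ ℚ≥0} (h : precV prec r s) {P : ℕ → Prop}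
    (hP : ∀ b c, prec b c → P b → P c) : massOn r P ≤ massOn s P := by
  refine (h.sum_le (Finset.filter_subset P _)).trans (massOn_mono s ?_)
  rintro c ⟨b, hb, hbc⟩
  exact hP b c hbc (Finset.mem_filter.1 hb).2

/-- Starting from `b` at level `n`, there is a `prec`-chain with `k` steps through the supports of
`s (n + 1), s (n + 2), …` whose last element does not satisfy `P`. -/
def AvoidingChain (prec : ℕ → ℕ → Prop) (s : ℕ → ℕ →₀ ℚ≥0) (P : ℕ → Prop) : ℕ → ℕ → ℕ → Prop
  | 0, _, b => ¬ P b
  | k + 1, n, b => ∃ c ∈ (s (n + 1)).support, prec b c ∧ AvoidingChain prec s P k (n + 1) c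

variable {s : ℕ → ℕ →₀ ℚ≥0} {P : ℕ → Prop}

theorem AvoidingChain.of_succ (hP : ∀ b c, prec b c → P b → P c) {k n b : ℕ}
    (h : AvoidingChain prec s P (k + 1) n b) : AvoidingChain prec s P k n b := by
  induction k generalizing n b with
  | zero =>
    obtain ⟨c, _, hbc, hc⟩ := h
    exact fun hb => hc (hP b c hbc hb)
  | succ k ih =>
    obtain ⟨c, hcs, hbc, hc⟩ := h
    exact ⟨c, hcs, hbc, ih hc⟩

theorem AvoidingChain.of_le (hP : ∀ b c, prec b c → P b → P c) {k l n b : ℕ} (hkl : k ≤ l)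
    (h : AvoidingChain prec s P l n b) : AvoidingChain prec s P k n b := by
  induction l, hkl using Nat.le_induction with
  | base => exact h
  | succ l _ ih => exact ih (h.of_succ hP)

theorem exists_forall_not_avoidingChain (hP : ∀ b c, prec b c → P b → P c) {n : ℕ}
    (S : Finset ℕ) (h : ∀ b ∈ S, ∃ k, ¬ AvoidingChain prec s P k n b) :
    ∃ k, ∀ b ∈ S, ¬ AvoidingChain prec s P k n b := by
  choose! f hf using h
  exact ⟨S.sup f, fun b hb hc => hf b hb (hc.of_le hP (Finset.le_sup hb))⟩

/-- König's lemma for avoiding chains. -/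
theorem exists_infinite_avoidingChain (hP : ∀ b c, prec b c → P b → P c) {b : ℕ}
    (h : ∀ k, AvoidingChain prec s P k 0 b) :
    ∃ c : ℕ → ℕ, c 0 = b ∧ (∀ n, prec (c n) (c (n + 1))) ∧ ∀ n, ¬ P (c n) := by
  have step : ∀ n a, (∀ k, AvoidingChain prec s P k n a) →
      ∃ c, prec a c ∧ ∀ k, AvoidingChain prec s P k (n + 1) c := by
    intro n a ha
    by_contra! hc
    obtain ⟨k, hk⟩ := exists_forall_not_avoidingChain (s := s) (n := n + 1) hP
      ((s (n + 1)).support.filter (prec a)) fun c hcS => hc c (Finset.mem_filter.1 hcS).2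
    obtain ⟨c, hcs, hac, hck⟩ := ha (k + 1)
    exact hk c (Finset.mem_filter.2 ⟨hcs, hac⟩) hck
  choose! f hf hf' using step
  let c : ℕ → ℕ := fun n => Nat.rec b f n
  have hc : ∀ n k, AvoidingChain prec s P k n (c n) := by
    intro n
    induction n with
    | zero => exact h
    | succ n ih => exact hf' n _ ih
  exact ⟨c, rfl, fun n => hf n _ (hc n), fun n => hc n 0⟩

/-- Mass is pushed along a `precV`-chain until it lies entirely on `P`. -/
theorem exists_sum_le_massOn (hs : ∀ n, precV prec (s n) (s (n + 1))) {k n : ℕ} {S : Finset ℕ}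
    (hS : S ⊆ (s n).support) (h : ∀ b ∈ S, ¬ AvoidingChain prec s P k n b) :
    ∃ m ≥ n, ∑ b ∈ S, s n b ≤ massOn (s m) P := by
  induction k generalizing n S with
  | zero =>
    refine ⟨n, le_rfl, Finset.sum_le_sum_of_subset fun b hb => ?_⟩
    exact Finset.mem_filter.2 ⟨hS hb, not_not.1 (h b hb)⟩
  | succ k ih =>
    obtain ⟨m, hm, hle⟩ := ih (n := n + 1)
      (S := (s (n + 1)).support.filter fun c => ∃ b ∈ S, prec b c)
      (Finset.filter_subset _ _) fun c hc hck => by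
        obtain ⟨hcs, b, hb, hbc⟩ := Finset.mem_filter.1 hc
        exact h b hb ⟨c, hcs, hbc, hck⟩
    refine ⟨m, (Nat.le_succ n).trans hm, ((hs n).sum_le hS).trans ?_⟩
    rw [massOn]
    convert hle

end Mass

section IdealSpace

variable {α : Type*} {prec : α → α → Prop}

theorem basicOpen_subset_of_prec {b c : α} (h : prec b c) :
    basicOpen prec c ⊆ basicOpen prec b :=
  fun J hJ => J.2.2.1 c hJ b h

theorem exists_basicOpen_subset {U : Set (IdealSpace prec)} (hU : IsOpen U)
    {J : IdealSpace prec} (hJ : J ∈ U) : ∃ u ∈ J.1, basicOpen prec u ⊆ U := by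
  induction hU with
  | basic V hV =>
    obtain ⟨n, rfl⟩ := hV
    exact ⟨n, hJ, subset_rfl⟩
  | univ =>
    obtain ⟨n, hn⟩ := J.2.1
    exact ⟨n, hn, Set.subset_univ _⟩
  | inter V W _ _ ihV ihW =>
    obtain ⟨v, hv, hvV⟩ := ihV hJ.1
    obtain ⟨w, hw, hwW⟩ := ihW hJ.2
    obtain ⟨u, hu, hvu, hwu⟩ := J.2.2.2 v hv w hw
    exact ⟨u, hu, Set.subset_inter ((basicOpen_subset_of_prec hvu).trans hvV)
      ((basicOpen_subset_of_prec hwu).trans hwW)⟩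
  | sUnion S _ ih =>
    obtain ⟨V, hV, hJV⟩ := hJ
    obtain ⟨u, hu, huV⟩ := ih V hV hJV
    exact ⟨u, hu, huV.trans (Set.subset_sUnion_of_mem hV)⟩

theorem isIdeal_of_chain (htrans : Transitive prec) {c : ℕ → α}
    (hc : ∀ n, prec (c n) (c (n + 1))) : IsIdeal prec {a | ∃ n, prec a (c n)} := by
  have up : ∀ {a n m}, n ≤ m → prec a (c n) → prec a (c m) := by
    intro a n m hnm ha
    induction m, hnm using Nat.le_induction with
    | base => exact ha
    | succ m _ ih => exact htrans ih (hc m)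
  refine ⟨⟨c 0, 1, hc 0⟩, fun a ⟨n, hn⟩ b hb => ⟨n, htrans hb hn⟩, ?_⟩
  rintro a ⟨n, hn⟩ b ⟨m, hm⟩
  exact ⟨c (max n m), ⟨_, hc _⟩, up (le_max_left n m) hn, up (le_max_right n m) hm⟩

theorem exists_basicOpen_subset_of_chain (htrans : Transitive prec) {c : ℕ → α}
    (hc : ∀ n, prec (c n) (c (n + 1))) {U V : Opens (IdealSpace prec)}
    (h : basicOpens prec (c 0) ≤ U ⊔ V) :
    ∃ n, basicOpens prec (c n) ≤ U ∨ basicOpens prec (c n) ≤ V := by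
  let J : IdealSpace prec := ⟨_, isIdeal_of_chain htrans hc⟩
  have hJ : J ∈ U ⊔ V := h (show J ∈ basicOpen prec (c 0) from ⟨1, hc 0⟩)
  rcases hJ with hJ | hJ
  · obtain ⟨u, ⟨n, hn⟩, hu⟩ := exists_basicOpen_subset U.isOpen hJ
    exact ⟨n, Or.inl ((basicOpen_subset_of_prec hn).trans hu)⟩
  · obtain ⟨u, ⟨n, hn⟩, hu⟩ := exists_basicOpen_subset V.isOpen hJ
    exact ⟨n, Or.inr ((basicOpen_subset_of_prec hn).trans hu)⟩

theorem basicOpens_le_of_prec (U : Opens (IdealSpace prec)) (b c : α) (hbc : prec b c)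
    (hb : basicOpens prec b ≤ U) : basicOpens prec c ≤ U :=
  (show basicOpens prec c ≤ basicOpens prec b from basicOpen_subset_of_prec hbc).trans hb

end IdealSpace

section GV

variable {prec : ℕ → ℕ → Prop} {I : Set (ℕ →₀ ℚ≥0)}

theorem unionOpens_le_iff {F : Finset ℕ} {U : Opens (IdealSpace prec)} :
    unionOpens prec F ≤ U ↔ ∀ b ∈ F, basicOpens prec b ≤ U :=
  Set.iUnion₂_subset_iff

theorem IsIdeal.filter_mem (hI : IsIdeal (precV prec) I) {r : ℕ →₀ ℚ≥0} (hr : r ∈ I)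
    (P : ℕ → Prop) : r.filter P ∈ I := by
  obtain ⟨s, hs, hrs, -⟩ := hI.2.2 r hr r hr
  refine hI.2.1 s hs _ fun F hF hFr => ?_
  rw [Finsupp.support_filter] at hFr
  refine lt_of_eq_of_lt (Finset.sum_congr rfl fun b hb => ?_)
    (hrs F hF (hFr.trans (Finset.filter_subset _ _)))
  exact Finsupp.filter_apply_pos P r (Finset.mem_filter.1 (hFr hb)).2

theorem gVfun_eq_iSup_massOn (hI : IsIdeal (precV prec) I) (U : Opens (IdealSpace prec)) :
    gVfun prec I U =
      ⨆ r : I, (((massOn r.1 (fun b => basicOpens prec b ≤ U) : ℚ≥0) : ℝ≥0) : ℝ≥0∞) := by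
  apply le_antisymm
  · refine iSup₂_le fun r hr => le_iSup_of_le ⟨r, hr.1⟩ (le_of_eq ?_)
    rw [massOn, Finset.filter_true_of_mem (unionOpens_le_iff.1 hr.2)]
    push_cast
    rfl
  · refine iSup_le fun r => le_iSup₂_of_le (r.1.filter fun b => basicOpens prec b ≤ U)
      ⟨hI.filter_mem r.2 _, ?_⟩ (le_of_eq ?_)
    · rw [unionOpens_le_iff, Finsupp.support_filter]
      exact fun b hb => (Finset.mem_filter.1 hb).2
    · rw [massOn, Finsupp.support_filter]
      push_cast
      refine Finset.sum_congr rfl fun b hb => ?_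
      rw [Finsupp.filter_apply_pos (fun b => basicOpens prec b ≤ U) _ (Finset.mem_filter.1 hb).2]

theorem IsIdeal.exists_precV_seq (hI : IsIdeal (precV prec) I) {r : ℕ →₀ ℚ≥0} (hr : r ∈ I) :
    ∃ s : ℕ → ℕ →₀ ℚ≥0, s 0 = r ∧ (∀ n, s n ∈ I) ∧ ∀ n, precV prec (s n) (s (n + 1)) := by
  have step : ∀ r ∈ I, ∃ t ∈ I, precV prec r t := fun r hr => by
    obtain ⟨t, ht, hrt, -⟩ := hI.2.2 r hr r hr
    exact ⟨t, ht, hrt⟩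
  choose! f hf hf' using step
  let s : ℕ → ℕ →₀ ℚ≥0 := fun n => Nat.rec r (fun _ => f) n
  have hs : ∀ n, s n ∈ I := fun n => by
    induction n with
    | zero => exact hr
    | succ n ih => exact hf _ ih
  exact ⟨s, rfl, hs, fun n => hf' _ (hs n)⟩

theorem IsIdeal.exists_massOn_sup_le (htrans : Transitive prec) (hI : IsIdeal (precV prec) I)
    {r : ℕ →₀ ℚ≥0} (hr : r ∈ I) (U V : Opens (IdealSpace prec)) :
    ∃ t ∈ I, massOn r (fun b => basicOpens prec b ≤ U ⊔ V) ≤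
        massOn t (fun b => basicOpens prec b ≤ U ∨ basicOpens prec b ≤ V) ∧
      massOn r (fun b => basicOpens prec b ≤ U ⊓ V) ≤
        massOn t (fun b => basicOpens prec b ≤ U ⊓ V) := by
  obtain ⟨s, rfl, hsI, hs⟩ := hI.exists_precV_seq hr
  have hP : ∀ b c, prec b c → (basicOpens prec b ≤ U ∨ basicOpens prec b ≤ V) →
      (basicOpens prec c ≤ U ∨ basicOpens prec c ≤ V) := fun b c hbc =>
    Or.imp (basicOpens_le_of_prec U b c hbc) (basicOpens_le_of_prec V b c hbc)
  obtain ⟨k, hk⟩ := exists_forall_not_avoidingChain (s := s) (n := 0) hP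
    ((s 0).support.filter fun b => basicOpens prec b ≤ U ⊔ V) fun b hb => by
      by_contra! h
      obtain ⟨c, rfl, hc, hcP⟩ := exists_infinite_avoidingChain hP h
      obtain ⟨n, hn⟩ := exists_basicOpen_subset_of_chain htrans hc (Finset.mem_filter.1 hb).2
      exact hcP n hn
  obtain ⟨m, -, hm⟩ := exists_sum_le_massOn hs (Finset.filter_subset _ _) hk
  exact ⟨s m, hsI m, hm, monotone_nat_of_le_succ
    (fun n => (hs n).massOn_le (basicOpens_le_of_prec (U ⊓ V))) (Nat.zero_le m)⟩

theorem IsIdeal.exists_massOn_le (hI : IsIdeal (precV prec) I) (U V : Opens (IdealSpace prec))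
    (r r' : I) : ∃ t : I,
      massOn r.1 (fun b => basicOpens prec b ≤ U) ≤ massOn t.1 (fun b => basicOpens prec b ≤ U) ∧
      massOn r'.1 (fun b => basicOpens prec b ≤ V) ≤
        massOn t.1 (fun b => basicOpens prec b ≤ V) := by
  obtain ⟨t, ht, h, h'⟩ := hI.2.2 r.1 r.2 r'.1 r'.2
  exact ⟨⟨t, ht⟩, h.massOn_le (basicOpens_le_of_prec U), h'.massOn_le (basicOpens_le_of_prec V)⟩

theorem gVfun_add_gVfun (hI : IsIdeal (precV prec) I) (U V : Opens (IdealSpace prec)) :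
    gVfun prec I U + gVfun prec I V =
      ⨆ r : I, (((massOn r.1 (fun b => basicOpens prec b ≤ U) +
        massOn r.1 (fun b => basicOpens prec b ≤ V) : ℚ≥0) : ℝ≥0) : ℝ≥0∞) := by
  rw [gVfun_eq_iSup_massOn hI, gVfun_eq_iSup_massOn hI, ENNReal.iSup_add_iSup]
  · push_cast
    rfl
  · intro r r'
    obtain ⟨t, h, h'⟩ := hI.exists_massOn_le U V r r'
    refine ⟨t, add_le_add ?_ ?_⟩ <;> exact_mod_cast ‹_›

end GV

/-- For an ideal `I` with respect to `≺_V`, the function `g_V(I)` is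
modular: `g_V(I)(U) + g_V(I)(V) = g_V(I)(U ∪ V) + g_V(I)(U ∩ V)`. -/
theorem gVfun_modular (prec : ℕ → ℕ → Prop) (htrans : Transitive prec)
    (I : Set (ℕ →₀ ℚ≥0)) (hI : IsIdeal (precV prec) I)
    (U V : Opens (IdealSpace prec)) :
    gVfun prec I U + gVfun prec I V = gVfun prec I (U ⊔ V) + gVfun prec I (U ⊓ V) := by
  rw [gVfun_add_gVfun hI, gVfun_add_gVfun hI]
  apply le_antisymm
  · refine iSup_mono fun r => ?_
    have h := (massOn_add_massOn r.1 (fun b => basicOpens prec b ≤ U)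
      (fun b => basicOpens prec b ≤ V)).le.trans
      (add_le_add (massOn_mono r.1 fun b hb => hb.elim le_sup_of_le_left le_sup_of_le_right)
        (massOn_mono r.1 fun b hb => le_inf hb.1 hb.2))
    exact_mod_cast h
  · refine iSup_le fun r => ?_
    obtain ⟨t, ht, hsup, hinf⟩ := hI.exists_massOn_sup_le htrans r.2 U V
    refine le_iSup_of_le ⟨t, ht⟩ ?_
    have h := (add_le_add hsup
      (hinf.trans (massOn_mono t fun b hb => le_inf_iff.1 hb))).trans
      (massOn_add_massOn t (fun b => basicOpens prec b ≤ U)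
        (fun b => basicOpens prec b ≤ V)).ge
    exact_mod_cast h
end

section
/- Let ≺ be a transitive relation on ℕ. The map g_V : I(≺_V) → V(I(≺)), g_V(I) = λU. sup { ∑_{b∈dom(r)} r(b) : r ∈ I and ⋃_{b∈dom(r)} [b]_≺ ⊆ U }, is continuous from the space of ideals I(≺_V) to the space of valuations on I(≺) with the weak topology. -/
open TopologicalSpace
open scoped Classical NNRat NNReal ENNReal

/-- For a fixed open set `U`, the map `I ↦ g_V(I)(U)` is lower semicontinuous: its strict
superlevel sets are unions of basic open sets `[r]_{≺_V}`. -/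
theorem isOpen_lt_gVfun (prec : ℕ → ℕ → Prop) (U : Opens (IdealSpace prec)) (q : ℝ≥0∞) :
    IsOpen {I : IdealSpace (precV prec) | q < gVfun prec I.1 U} := by
  have h : {I : IdealSpace (precV prec) | q < gVfun prec I.1 U} =
      ⋃ r ∈ {r : ℕ →₀ ℚ≥0 | unionOpens prec r.support ≤ U ∧
        q < ∑ b ∈ r.support, ((r b : ℝ≥0) : ℝ≥0∞)}, basicOpen (precV prec) r := by
    ext I
    simp only [gVfun, lt_iSup_iff, basicOpen, Set.mem_ofPred_eq, Set.mem_iUnion, exists_prop]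
    exact exists_congr fun r => by tauto
  rw [h]
  exact isOpen_biUnion fun r _ => isOpen_basicOpen _ r

/-- The map `g_V : I(≺_V) → V(I(≺))` is continuous from the space of ideals
of `≺_V` to the space of valuations on `I(≺)` with the weak topology. -/
theorem gV_continuous (prec : ℕ → ℕ → Prop) (htrans : Transitive prec)
    (gV : IdealSpace (precV prec) → Valuation' (IdealSpace prec))
    (hgV : ∀ I, (gV I).toFun = gVfun prec I.1) :
    Continuous gV := by
  refine continuous_generateFrom_iff.2 ?_
  rintro _ ⟨U, q, -, rfl⟩
  simpa only [Set.preimage_ofPred_eq, hgV] using isOpen_lt_gVfun prec U q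
end
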